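/- If M = 7, or M is a product of primes each congruent to 1 modulo 4, then the lattice D4 has a clean, geometrically strictly similar sublattice of index M². -/

import Mathlib

/-- The lattice `D4 = {x ∈ ℤ⁴ : x 0 + x 1 + x 2 + x 3 is even}` inside
`EuclideanSpace ℝ (Fin 4)`. -/
noncomputable def D4 : AddSubgroup (EuclideanSpace ℝ (Fin 4)) where
  carrier := {x | ∃ v : Fin 4 → ℤ, (∀ i, x i = (v i : ℝ)) ∧ Even (v 0 + v 1 + v 2 + v 3)}
  zero_mem' := ⟨0, fun i => by simp, by simp⟩
  add_mem' := by
    rintro x y ⟨v, hv, kv, hkv⟩ ⟨w, hw, kw, hkw⟩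
    refine ⟨v + w, fun i => ?_, kv + kw, by simp only [Pi.add_apply]; omega⟩
    have : (x + y) i = x i + y i := rfl
    rw [this, hv i, hw i, Pi.add_apply]
    push_cast
    ring
  neg_mem' := by
    rintro x ⟨v, hv, kv, hkv⟩
    refine ⟨-v, fun i => ?_, -kv, by simp only [Pi.neg_apply]; omega⟩
    have : (-x) i = -(x i) := rfl
    rw [this, hv i, Pi.neg_apply]
    push_cast
    ring

/-- `Λ'` is clean in `Λ`: every point of `Λ` has a unique nearest point of `Λ'`
in the Euclidean norm. -/
def IsClean (Λ Λ' : AddSubgroup (EuclideanSpace ℝ (Fin 4))) : Prop :=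
  ∀ x ∈ Λ, ∃! p, p ∈ Λ' ∧ ∀ q ∈ Λ', ‖x - p‖ ≤ ‖x - q‖

/-- `Λ'` is a geometrically similar sublattice of `Λ` of index `N`:
`Λ' = {c·O(v) : v ∈ Λ}` for some `c > 0` and orthogonal matrix `O`, with
`[Λ : Λ'] = N`. -/
def IsSimilarSublattice (Λ Λ' : AddSubgroup (EuclideanSpace ℝ (Fin 4))) (N : ℕ) : Prop :=
  Λ' ≤ Λ ∧ (Λ'.addSubgroupOf Λ).index = N ∧
    ∃ (c : ℝ) (O : Matrix (Fin 4) (Fin 4) ℝ), 0 < c ∧ O * O.transpose = 1 ∧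
      Λ' = AddSubgroup.map (c • Matrix.toEuclideanLin O).toAddMonoidHom Λ

/-- `Λ'` is a geometrically strictly similar sublattice of `Λ` of index `N`:
as above, but additionally `det O = 1` (no reflections). -/
def IsStrictlySimilarSublattice (Λ Λ' : AddSubgroup (EuclideanSpace ℝ (Fin 4))) (N : ℕ) : Prop :=
  Λ' ≤ Λ ∧ (Λ'.addSubgroupOf Λ).index = N ∧
    ∃ (c : ℝ) (O : Matrix (Fin 4) (Fin 4) ℝ), 0 < c ∧ O * O.transpose = 1 ∧ O.det = 1 ∧
      Λ' = AddSubgroup.map (c • Matrix.toEuclideanLin O).toAddMonoidHom Λ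

/-- The matrix of left multiplication by the quaternion `a + b i + c j + d k`. -/
def quatMatrix (a b c d : ℤ) : Matrix (Fin 4) (Fin 4) ℤ :=
  !![a, -b, -c, -d; b, a, -d, c; c, d, a, -b; d, -c, b, a]

theorem quatMatrix_det (a b c d : ℤ) :
    (quatMatrix a b c d).det = (a ^ 2 + b ^ 2 + c ^ 2 + d ^ 2) ^ 2 := by
  simp [quatMatrix, Matrix.det_succ_row_zero, Fin.sum_univ_succ, Fin.succAbove]
  ring

theorem quatMatrix_mul_transpose (a b c d : ℤ) :
    quatMatrix a b c d * (quatMatrix a b c d).transpose =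
      (a ^ 2 + b ^ 2 + c ^ 2 + d ^ 2) • (1 : Matrix (Fin 4) (Fin 4) ℤ) := by
  ext i j
  fin_cases i <;> fin_cases j <;>
    simp [quatMatrix, Matrix.mul_apply, Fin.sum_univ_four] <;> ring

theorem quatMatrix_transpose_mul (a b c d : ℤ) :
    (quatMatrix a b c d).transpose * quatMatrix a b c d =
      (a ^ 2 + b ^ 2 + c ^ 2 + d ^ 2) • (1 : Matrix (Fin 4) (Fin 4) ℤ) := by
  ext i j
  fin_cases i <;> fin_cases j <;>
    simp [quatMatrix, Matrix.mul_apply, Fin.sum_univ_four] <;> ring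

/-- The integer vectors with even coordinate sum. -/
def evenVectors : AddSubgroup (Fin 4 → ℤ) where
  carrier := {v | Even (v 0 + v 1 + v 2 + v 3)}
  zero_mem' := by simp
  add_mem' := by
    rintro v w ⟨k, hk⟩ ⟨l, hl⟩
    exact ⟨k + l, by simp only [Pi.add_apply]; omega⟩
  neg_mem' := by
    rintro v ⟨k, hk⟩
    exact ⟨-k, by simp only [Pi.neg_apply]; omega⟩

theorem mem_evenVectors {v : Fin 4 → ℤ} :
    v ∈ evenVectors ↔ Even (v 0 + v 1 + v 2 + v 3) := Iff.rfl

theorem evenVectors_index_ne_zero : evenVectors.index ≠ 0 := by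
  let f : (Fin 4 → ℤ) →+ ZMod 2 :=
    { toFun := fun v => ((v 0 + v 1 + v 2 + v 3 : ℤ) : ZMod 2)
      map_zero' := by simp
      map_add' := by intro v w; simp only [Pi.add_apply]; push_cast; ring }
  have hf : evenVectors = f.ker := by
    ext v
    rw [AddMonoidHom.mem_ker, mem_evenVectors]
    exact (ZMod.intCast_eq_zero_iff_even).symm
  rw [hf, AddSubgroup.index_ker]
  exact Nat.card_pos.ne'

theorem quatMatrix_mulVec_mem (a b c d : ℤ) {v : Fin 4 → ℤ} (hv : v ∈ evenVectors) :
    (quatMatrix a b c d).mulVec v ∈ evenVectors := by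
  obtain ⟨k, hk⟩ := hv
  refine ⟨(a + b + c + d) * k - (b + c) * v 1 - (c + d) * v 2 - (b + d) * v 3, ?_⟩
  simp [quatMatrix, Matrix.mulVec, dotProduct, Fin.sum_univ_four]
  linear_combination (a + b + c + d) * hk

theorem quatMatrix_transpose_mulVec_mem (a b c d : ℤ) {v : Fin 4 → ℤ} (hv : v ∈ evenVectors) :
    (quatMatrix a b c d).transpose.mulVec v ∈ evenVectors := by
  have : (quatMatrix a b c d).transpose = quatMatrix a (-b) (-c) (-d) := by
    ext i j
    fin_cases i <;> fin_cases j <;> simp [quatMatrix]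
  rw [this]
  exact quatMatrix_mulVec_mem _ _ _ _ hv

/-- The inclusion of the integer vectors into Euclidean space. -/
noncomputable def intEmbedding : (Fin 4 → ℤ) →+ EuclideanSpace ℝ (Fin 4) where
  toFun v := WithLp.toLp 2 (fun i => (v i : ℝ))
  map_zero' := by ext i; simp
  map_add' v w := by ext i; simp

theorem intEmbedding_apply (v : Fin 4 → ℤ) (i : Fin 4) : intEmbedding v i = (v i : ℝ) := rfl

theorem intEmbedding_injective : Function.Injective intEmbedding := by
  intro v w h
  funext i
  have : intEmbedding v i = intEmbedding w i := by rw [h]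
  simpa [intEmbedding_apply] using this

theorem D4_eq_map : D4 = evenVectors.map intEmbedding := by
  ext x
  constructor
  · rintro ⟨v, hv, he⟩
    refine ⟨v, he, ?_⟩
    ext i
    rw [intEmbedding_apply, hv i]
  · rintro ⟨v, he, rfl⟩
    exact ⟨v, fun i => rfl, he⟩

theorem index_range_mulVecLin {A : Matrix (Fin 4) (Fin 4) ℤ} (hA : A.det ≠ 0) :
    A.mulVecLin.toAddMonoidHom.range.index = A.det.natAbs := by
  have hinj : Function.Injective A.mulVecLin := Matrix.mulVec_injective_of_det_ne_zero hA
  let e := LinearEquiv.ofInjective A.mulVecLin hinj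
  let b := (Pi.basisFun ℤ (Fin 4)).map e
  have := Submodule.natAbs_det_basis_change (Pi.basisFun ℤ (Fin 4)) (LinearMap.range A.mulVecLin) b
  have h2 : (Subtype.val ∘ b : Fin 4 → Fin 4 → ℤ) = fun i j => A j i := by
    funext i j
    simp [b, e]
  have h3 : (Pi.basisFun ℤ (Fin 4)).det (fun i j => A j i) = A.det := by
    rw [Pi.basisFun_det_apply]
    exact Matrix.det_transpose A
  rw [h2, h3] at this
  rw [this]
  rfl

theorem relIndex_map_mulVecLin {A : Matrix (Fin 4) (Fin 4) ℤ} (hA : A.det ≠ 0)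
    {D : AddSubgroup (Fin 4 → ℤ)} (hD : D.index ≠ 0)
    (hAD : D.map A.mulVecLin.toAddMonoidHom ≤ D) :
    (D.map A.mulVecLin.toAddMonoidHom).relIndex D = A.det.natAbs := by
  have hinj : Function.Injective A.mulVecLin.toAddMonoidHom :=
    Matrix.mulVec_injective_of_det_ne_zero hA
  have h1 := AddSubgroup.relIndex_mul_index hAD
  have h2 := AddSubgroup.relIndex_mul_index
    (AddSubgroup.map_mono (f := A.mulVecLin.toAddMonoidHom) (le_top : D ≤ ⊤))
  rw [AddSubgroup.relIndex_map_map_of_injective _ _ hinj, AddSubgroup.relIndex_top_right,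
    ← AddMonoidHom.range_eq_map, index_range_mulVecLin hA, ← h1, mul_comm] at h2
  exact (Nat.eq_of_mul_eq_mul_right (Nat.pos_of_ne_zero hD) h2).symm

/-- The Voronoi cell of the scaled lattice `M • D4` is cut out by the roots of `D4`; here the
coordinate `m` has the largest absolute value. -/
theorem lt_of_root_bounds_of_max {M m n₁ n₂ n₃ p q₁ q₂ q₃ : ℤ}
    (h₁ : |m| + |n₁| < M) (h₂ : |m| + |n₂| < M) (h₃ : |m| + |n₃| < M)
    (k₁ : |n₁| ≤ |m|) (k₂ : |n₂| ≤ |m|) (k₃ : |n₃| ≤ |m|)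
    (he : Even (p + q₁ + q₂ + q₃)) (h0 : ¬ (p = 0 ∧ q₁ = 0 ∧ q₂ = 0 ∧ q₃ = 0)) :
    2 * (m * p + n₁ * q₁ + n₂ * q₂ + n₃ * q₃) < M * (p ^ 2 + q₁ ^ 2 + q₂ ^ 2 + q₃ ^ 2) := by
  obtain ⟨n, hn, l₁, l₂, l₃, hnm⟩ : ∃ n : ℤ, |m| + n < M ∧ |n₁| ≤ n ∧ |n₂| ≤ n ∧ |n₃| ≤ n ∧
      n ≤ |m| :=
    ⟨max |n₁| (max |n₂| |n₃|), by omega, by omega, by omega, by omega, by omega⟩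
  have hn0 : 0 ≤ n := (abs_nonneg _).trans l₁
  have hm0 := abs_nonneg m
  have hmp : m * p ≤ |m| * |p| := (le_abs_self _).trans (abs_mul _ _).le
  have hq : ∀ {x y : ℤ}, |x| ≤ n → x * y ≤ n * |y| := fun {x y} hx =>
    (le_abs_self _).trans ((abs_mul _ _).le.trans (mul_le_mul_of_nonneg_right hx (abs_nonneg _)))
  have e₁ := hq (y := q₁) l₁
  have e₂ := hq (y := q₂) l₂
  have e₃ := hq (y := q₃) l₃
  have hs : ∀ y : ℤ, |y| ≤ y ^ 2 := fun y => by
    rw [← sq_abs]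
    have := abs_nonneg y
    rcases this.eq_or_lt with h | h
    · rw [← h]; norm_num
    · nlinarith
  have s₁ := hs q₁
  have s₂ := hs q₂
  have s₃ := hs q₃
  obtain ⟨S, hS⟩ : ∃ S, S = |q₁| + |q₂| + |q₃| := ⟨_, rfl⟩
  have hS2 : M * S ≤ M * (q₁ ^ 2 + q₂ ^ 2 + q₃ ^ 2) :=
    mul_le_mul_of_nonneg_left (by omega) (by omega)
  suffices h : 2 * (|m| * |p| + n * S) < M * (|p| ^ 2 + S) by
    rw [sq_abs] at h
    subst hS
    nlinarith
  have hSp : 0 < |p| + S ∧ 0 ≤ S ∧ Even (|p| + S) := by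
    refine ⟨?_, ?_, ?_⟩
    · by_contra hneg
      have := abs_nonneg p
      have := abs_nonneg q₁
      have := abs_nonneg q₂
      have := abs_nonneg q₃
      exact h0 ⟨abs_eq_zero.mp (by omega), abs_eq_zero.mp (by omega),
        abs_eq_zero.mp (by omega), abs_eq_zero.mp (by omega)⟩
    · rw [hS]
      positivity
    · rw [Int.even_iff] at he ⊢
      rcases abs_choice p with a0 | a0 <;> rcases abs_choice q₁ with a1 | a1 <;>
        rcases abs_choice q₂ with a2 | a2 <;> rcases abs_choice q₃ with a3 | a3 <;> omega
  obtain ⟨hpos, hS0, heven⟩ := hSp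
  have hp0 := abs_nonneg p
  generalize |p| = P at *
  rcases (by omega : P = 0 ∨ P = 1 ∨ 2 ≤ P) with rfl | rfl | hP
  · nlinarith
  · have : 1 ≤ S := by
      rw [Int.even_iff] at heven
      omega
    nlinarith
  · have i1 : 2 * n * S ≤ M * S := mul_le_mul_of_nonneg_right (by omega) hS0
    have i2 : |m| * P < M * P := mul_lt_mul_of_pos_right (by omega) (by omega)
    have i3 : M * (2 * P) ≤ M * P ^ 2 := mul_le_mul_of_nonneg_left (by nlinarith) (by omega)
    nlinarith

theorem lt_of_root_bounds {M : ℤ} {u d : Fin 4 → ℤ} (hu : ∀ i j, i ≠ j → |u i| + |u j| < M)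
    (hd : d ∈ evenVectors) (h0 : d ≠ 0) :
    2 * (u 0 * d 0 + u 1 * d 1 + u 2 * d 2 + u 3 * d 3) <
      M * (d 0 ^ 2 + d 1 ^ 2 + d 2 ^ 2 + d 3 ^ 2) := by
  have h0' : ¬ (d 0 = 0 ∧ d 1 = 0 ∧ d 2 = 0 ∧ d 3 = 0) := by
    rintro ⟨a0, a1, a2, a3⟩
    apply h0
    funext i
    fin_cases i <;> simpa
  rw [mem_evenVectors, Int.even_iff] at hd
  obtain ⟨i, -, hi⟩ := Finset.exists_max_image Finset.univ (fun i => |u i|) Finset.univ_nonempty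
  have m0 := hi 0 (Finset.mem_univ _)
  have m1 := hi 1 (Finset.mem_univ _)
  have m2 := hi 2 (Finset.mem_univ _)
  have m3 := hi 3 (Finset.mem_univ _)
  fin_cases i
  · have := lt_of_root_bounds_of_max (p := d 0) (q₁ := d 1) (q₂ := d 2) (q₃ := d 3)
      (hu 0 1 (by decide)) (hu 0 2 (by decide)) (hu 0 3 (by decide)) m1 m2 m3
      (by rw [Int.even_iff]; omega) (by tauto)
    linarith
  · have := lt_of_root_bounds_of_max (p := d 1) (q₁ := d 0) (q₂ := d 2) (q₃ := d 3)
      (hu 1 0 (by decide)) (hu 1 2 (by decide)) (hu 1 3 (by decide)) m0 m2 m3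
      (by rw [Int.even_iff]; omega) (by tauto)
    linarith
  · have := lt_of_root_bounds_of_max (p := d 2) (q₁ := d 0) (q₂ := d 1) (q₃ := d 3)
      (hu 2 0 (by decide)) (hu 2 1 (by decide)) (hu 2 3 (by decide)) m0 m1 m3
      (by rw [Int.even_iff]; omega) (by tauto)
    linarith
  · have := lt_of_root_bounds_of_max (p := d 3) (q₁ := d 0) (q₂ := d 1) (q₃ := d 2)
      (hu 3 0 (by decide)) (hu 3 1 (by decide)) (hu 3 2 (by decide)) m0 m1 m2
      (by rw [Int.even_iff]; omega) (by tauto)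
    linarith

/-- The integer quadratic form `x 0 ^ 2 + x 1 ^ 2 + x 2 ^ 2 + x 3 ^ 2`. -/
def normSq4 (x : Fin 4 → ℤ) : ℤ := x 0 ^ 2 + x 1 ^ 2 + x 2 ^ 2 + x 3 ^ 2

theorem normSq4_nonneg (x : Fin 4 → ℤ) : 0 ≤ normSq4 x := by
  unfold normSq4
  positivity

theorem normSq4_sub_smul (M : ℤ) (u d : Fin 4 → ℤ) :
    normSq4 (u - M • d) = normSq4 u + M * (M * normSq4 d
      - 2 * (u 0 * d 0 + u 1 * d 1 + u 2 * d 2 + u 3 * d 3)) := by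
  simp only [normSq4, Pi.sub_apply, Pi.smul_apply, smul_eq_mul]
  ring

theorem norm_intEmbedding_sq (v : Fin 4 → ℤ) : ‖intEmbedding v‖ ^ 2 = (normSq4 v : ℝ) := by
  rw [EuclideanSpace.real_norm_sq_eq, Fin.sum_univ_four]
  simp [intEmbedding_apply, normSq4]

/-- Every coset of `M • D4` has a shortest vector, which satisfies all root inequalities. -/
theorem exists_root_reduced {M : ℤ} (hM : 0 < M) (y : Fin 4 → ℤ) :
    ∃ w ∈ evenVectors, ∀ i j, i ≠ j → |(y - M • w) i| + |(y - M • w) j| ≤ M := by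
  obtain ⟨w, hw, hmin⟩ : ∃ w ∈ evenVectors, ∀ w' ∈ evenVectors,
      normSq4 (y - M • w) ≤ normSq4 (y - M • w') := by
    have hne : (evenVectors : Set (Fin 4 → ℤ)).Nonempty := ⟨0, evenVectors.zero_mem⟩
    let f : (Fin 4 → ℤ) → ℕ := fun w => (normSq4 (y - M • w)).toNat
    refine ⟨Function.argminOn f (evenVectors : Set (Fin 4 → ℤ)) hne,
      Function.argminOn_mem f _ hne, fun w' hw' => ?_⟩
    have h := Function.argminOn_le f (evenVectors : Set (Fin 4 → ℤ)) (a := w') hw'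
    have h1 := normSq4_nonneg (y - M • w')
    simp only [f] at h ⊢
    omega
  refine ⟨w, hw, ?_⟩
  generalize hu : y - M • w = u at *
  have key : ∀ d ∈ evenVectors,
      2 * (u 0 * d 0 + u 1 * d 1 + u 2 * d 2 + u 3 * d 3) ≤ M * normSq4 d := by
    intro d hd
    have h := hmin (w + d) (evenVectors.add_mem hw hd)
    have e : y - M • (w + d) = u - M • d := by rw [← hu, smul_add]; abel
    rw [e, normSq4_sub_smul] at h
    nlinarith
  have root : ∀ i j, i ≠ j → ∀ s t : ℤ, (s = 1 ∨ s = -1) → (t = 1 ∨ t = -1) →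
      s * u i + t * u j ≤ M := by
    intro i j hij s t hs ht
    have hev : Even (s + t) ∧ Even (t + s) := by
      rcases hs with rfl | rfl <;> rcases ht with rfl | rfl <;> decide
    have h := key (Pi.single i s + Pi.single j t)
    revert h
    rw [mem_evenVectors]
    clear hmin key
    rcases hs with rfl | rfl <;> rcases ht with rfl | rfl <;>
      fin_cases i <;> fin_cases j <;> simp_all [normSq4] <;> intro h <;> linarith
  intro i j hij
  rcases abs_choice (u i) with h1 | h1 <;> rcases abs_choice (u j) with h2 | h2 <;>
    rw [h1, h2]
  · linarith [root i j hij 1 1 (by simp) (by simp)]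
  · linarith [root i j hij 1 (-1) (by simp) (by simp)]
  · linarith [root i j hij (-1) 1 (by simp) (by simp)]
  · linarith [root i j hij (-1) (-1) (by simp) (by simp)]

theorem normSq4_transpose_mulVec (a b c d : ℤ) (z : Fin 4 → ℤ) :
    normSq4 ((quatMatrix a b c d).transpose.mulVec z) =
      (a ^ 2 + b ^ 2 + c ^ 2 + d ^ 2) * normSq4 z := by
  simp [normSq4, quatMatrix, Matrix.mulVec, dotProduct, Fin.sum_univ_four]
  ring

/-- Left multiplication by a quaternion of norm `M` yields a clean sublattice of `D4` as soon as
no vector of the conjugate sublattice lies on the boundary of the Voronoi cell of `M • D4`. -/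
theorem exists_clean_of_quatMatrix {M : ℕ} (hM : 0 < M) {a b c d : ℤ}
    (hN : a ^ 2 + b ^ 2 + c ^ 2 + d ^ 2 = M)
    (key : ∀ v ∈ evenVectors, ∀ u, u = (quatMatrix a b c d).transpose.mulVec v →
      (∀ i j, i ≠ j → |u i| + |u j| ≤ M) → ∀ i j, i ≠ j → |u i| + |u j| ≠ M) :
    ∃ Λ' : AddSubgroup (EuclideanSpace ℝ (Fin 4)),
      IsStrictlySimilarSublattice D4 Λ' (M ^ 2) ∧ IsClean D4 Λ' := by
  set A := quatMatrix a b c d with hA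
  have hdet : A.det = (M : ℤ) ^ 2 := by rw [hA, quatMatrix_det, hN]
  have hMR : (0 : ℝ) < M := by exact_mod_cast hM
  have hle : evenVectors.map A.mulVecLin.toAddMonoidHom ≤ evenVectors := by
    rintro _ ⟨v, hv, rfl⟩
    exact quatMatrix_mulVec_mem _ _ _ _ hv
  have hdet0 : A.det ≠ 0 := by rw [hdet]; positivity
  refine ⟨(evenVectors.map A.mulVecLin.toAddMonoidHom).map intEmbedding, ⟨?_, ?_, ?_⟩, ?_⟩
  · rw [D4_eq_map]
    exact AddSubgroup.map_mono hle
  · change AddSubgroup.relIndex _ _ = _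
    rw [D4_eq_map, AddSubgroup.relIndex_map_map_of_injective _ _ intEmbedding_injective,
      relIndex_map_mulVecLin hdet0 evenVectors_index_ne_zero hle, hdet, Int.natAbs_pow,
      Int.natAbs_natCast]
  · have hs : √(M : ℝ) ^ 2 = M := Real.sq_sqrt hMR.le
    have hs0 : 0 < √(M : ℝ) := Real.sqrt_pos.mpr hMR
    refine ⟨√M, (√M)⁻¹ • A.map (Int.cast : ℤ → ℝ), hs0, ?_, ?_, ?_⟩
    · have h := congrArg (fun B : Matrix (Fin 4) (Fin 4) ℤ => B.map (Int.castRingHom ℝ))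
        (quatMatrix_mul_transpose a b c d)
      simp only [Matrix.map_mul, hN] at h
      rw [Matrix.transpose_smul, Matrix.smul_mul, Matrix.mul_smul, smul_smul]
      have h' : A.map (Int.cast : ℤ → ℝ) * (A.map (Int.cast : ℤ → ℝ)).transpose =
          (M : ℝ) • 1 := by
        refine Eq.trans h ?_
        ext i j
        simp only [Matrix.map_apply, Matrix.smul_apply, Matrix.one_apply]
        split_ifs <;> simp
      rw [h', smul_smul, ← mul_inv, ← sq, hs, inv_mul_cancel₀ hMR.ne', one_smul]
    · have h : (A.map (Int.cast : ℤ → ℝ)).det = (M : ℝ) ^ 2 := by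
        have := (Int.castRingHom ℝ).map_det A
        rw [hdet] at this
        simpa using this.symm
      rw [Matrix.det_smul, h, Fintype.card_fin, inv_pow, show √(M : ℝ) ^ 4 = (√M ^ 2) ^ 2 by ring, hs]
      exact inv_mul_cancel₀ (by positivity)
    · rw [D4_eq_map, AddSubgroup.map_map, AddSubgroup.map_map]
      congr 1
      refine AddMonoidHom.ext fun v => ?_
      ext i
      simp [intEmbedding_apply, Matrix.mulVec, dotProduct, Matrix.toLpLin_apply,
        Fin.sum_univ_four]
      field_simp
  · intro x hx
    rw [D4_eq_map] at hx
    obtain ⟨v, hv, rfl⟩ := hx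
    have hMZ : (0 : ℤ) < M := by exact_mod_cast hM
    obtain ⟨w, hw, hred⟩ := exists_root_reduced hMZ (A.transpose.mulVec v)
    have hdual : ∀ w, A.transpose.mulVec (v - A.mulVec w) =
        A.transpose.mulVec v - (M : ℤ) • w := by
      intro w
      rw [Matrix.mulVec_sub, Matrix.mulVec_mulVec, hA, quatMatrix_transpose_mul, hN,
        Matrix.smul_mulVec, Matrix.one_mulVec]
    have hnorm : ∀ w, (M : ℝ) * ‖intEmbedding v - intEmbedding (A.mulVec w)‖ ^ 2 =
        (normSq4 (A.transpose.mulVec v - (M : ℤ) • w) : ℝ) := by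
      intro w
      rw [← map_sub, norm_intEmbedding_sq, ← hdual, hA, normSq4_transpose_mulVec, hN]
      push_cast
      ring
    have hstrict : ∀ w' ∈ evenVectors, w' ≠ w →
        ‖intEmbedding v - intEmbedding (A.mulVec w)‖ <
          ‖intEmbedding v - intEmbedding (A.mulVec w')‖ := by
      intro w' hw' hne
      have hkey := key (v - A.mulVec w)
        (evenVectors.sub_mem hv (quatMatrix_mulVec_mem _ _ _ _ hw)) _ (hdual w).symm hred
      have hlt := lt_of_root_bounds (fun i j hij => lt_of_le_of_ne (hred i j hij) (hkey i j hij))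
        (evenVectors.sub_mem hw' hw) (sub_ne_zero.mpr hne)
      have hsplit : A.transpose.mulVec v - (M : ℤ) • w' =
          (A.transpose.mulVec v - (M : ℤ) • w) - (M : ℤ) • (w' - w) := by
        rw [smul_sub]; abel
      have hlt' : normSq4 (A.transpose.mulVec v - (M : ℤ) • w) <
          normSq4 (A.transpose.mulVec v - (M : ℤ) • w') := by
        rw [hsplit, normSq4_sub_smul _ (A.transpose.mulVec v - (M : ℤ) • w)]
        have := mul_pos hMZ (sub_pos.mpr hlt)
        unfold normSq4 at this ⊢
        linarith
      have hR : (M : ℝ) * ‖intEmbedding v - intEmbedding (A.mulVec w)‖ ^ 2 <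
          M * ‖intEmbedding v - intEmbedding (A.mulVec w')‖ ^ 2 := by
        rw [hnorm, hnorm]
        exact_mod_cast hlt'
      exact lt_of_pow_lt_pow_left₀ 2 (norm_nonneg _) (lt_of_mul_lt_mul_left hR hMR.le)
    refine ⟨intEmbedding (A.mulVec w), ⟨⟨_, ⟨w, hw, rfl⟩, rfl⟩, ?_⟩, ?_⟩
    · rintro _ ⟨_, ⟨w', hw', rfl⟩, rfl⟩
      by_cases h : w' = w
      · rw [h]; rfl
      · exact (hstrict w' hw' h).le
    · rintro _ ⟨⟨_, ⟨w', hw', rfl⟩, rfl⟩, hmin⟩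
      by_contra h
      have hne : w' ≠ w := by
        rintro rfl
        exact h rfl
      exact absurd (hmin _ ⟨_, ⟨w, hw, rfl⟩, rfl⟩) (not_le.mpr (hstrict w' hw' hne))

theorem exists_isCoprime_sq_add_sq {M : ℕ} (hM : 0 < M)
    (h : ∀ p : ℕ, p.Prime → p ∣ M → p % 4 = 1) :
    ∃ a b : ℤ, IsCoprime a b ∧ a ^ 2 + b ^ 2 = M := by
  induction M using induction_on_primes with
  | zero => omega
  | one => exact ⟨1, 0, isCoprime_one_left, by norm_num⟩
  | prime_mul p n hp ih =>
    obtain ⟨a, b, hab, hn⟩ := ih (Nat.pos_of_mul_pos_left hM)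
      (fun q hq hqn => h q hq (hqn.mul_left p))
    have hp4 := h p hp (dvd_mul_right p n)
    have := Fact.mk hp
    obtain ⟨c, d, hcd⟩ := Nat.Prime.sq_add_sq (p := p) (by omega)
    have hpZ : Prime (p : ℤ) := Nat.prime_iff_prime_int.mp hp
    have hcdZ : (c : ℤ) ^ 2 + (d : ℤ) ^ 2 = p := by exact_mod_cast hcd
    have hndvd : ∀ e f : ℕ, e ^ 2 + f ^ 2 = p → ¬ (p : ℤ) ∣ e := by
      intro e f hef hdvd
      have h1 : p ∣ e := by exact_mod_cast hdvd
      rcases Nat.eq_zero_or_pos e with rfl | he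
      · have hpp : f ^ 2 = p := by simpa using hef
        exact Nat.Prime.not_prime_pow (le_refl 2) (hpp ▸ hp)
      · have := Nat.le_of_dvd he h1
        have := hp.two_le
        nlinarith
    have h2 : ¬ (p : ℤ) ∣ 2 := by
      intro hdvd
      have h3 : p ∣ 2 := by exact_mod_cast hdvd
      have := Nat.le_of_dvd two_pos h3
      have := hp.two_le
      interval_cases p
      omega
    have hq_dvd : ∀ q x y : ℤ, Prime q → q ∣ x * p → q ∣ y * p → IsCoprime x y → q ∣ p := by
      intro q x y hq hx hy hxy
      by_contra hqp
      exact hq.not_isUnit (hxy.isUnit_of_dvd' ((hq.dvd_or_dvd hx).resolve_right hqp)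
        ((hq.dvd_or_dvd hy).resolve_right hqp))
    have coprime_of : ∀ x y : ℤ, (∃ s t : ℤ, s ^ 2 + t ^ 2 = p ∧ x = a * s - b * t ∧
        y = a * t + b * s) → ¬ ((p : ℤ) ∣ x ∧ (p : ℤ) ∣ y) → IsCoprime x y := by
      rintro x y ⟨s, t, hst, rfl, rfl⟩ hnot
      by_contra hnc
      have hx0 : ¬ (a * s - b * t = 0 ∧ a * t + b * s = 0) := by
        rintro ⟨e1, e2⟩
        exact hnot ⟨by rw [e1]; exact dvd_zero _, by rw [e2]; exact dvd_zero _⟩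
      apply hnc
      refine isCoprime_of_prime_dvd hx0 ?_
      intro q hq hqx hqy
      have hqp : q ∣ p := hq_dvd q a b hq
        ((by linear_combination a * hst :
          s * (a * s - b * t) + t * (a * t + b * s) = a * p) ▸
            dvd_add (hqx.mul_left s) (hqy.mul_left t))
        ((by linear_combination b * hst :
          s * (a * t + b * s) - t * (a * s - b * t) = b * p) ▸
            dvd_sub (hqy.mul_left s) (hqx.mul_left t)) hab
      have hassoc := (hq.associated_of_dvd hpZ hqp).symm
      exact hnot ⟨hassoc.dvd.trans hqx, hassoc.dvd.trans hqy⟩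
    have hval : ∀ s t : ℤ, s ^ 2 + t ^ 2 = p →
        (a * s - b * t) ^ 2 + (a * t + b * s) ^ 2 = ((p * n : ℕ) : ℤ) := by
      intro s t hst
      push_cast
      rw [← hn, ← hst]
      ring
    by_cases hcase : (p : ℤ) ∣ a * c - b * d ∧ (p : ℤ) ∣ a * d + b * c
    · have hst : (c : ℤ) ^ 2 + (-d : ℤ) ^ 2 = p := by rw [neg_sq, hcdZ]
      refine ⟨a * c - b * (-d), a * (-d) + b * c, coprime_of _ _ ⟨c, -d, hst, rfl, rfl⟩ ?_,
        hval _ _ hst⟩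
      rintro ⟨g1, g2⟩
      have ha : (p : ℤ) ∣ 2 * (c * a) := by
        have := dvd_add hcase.1 g1
        ring_nf at this ⊢
        exact this
      have hb : (p : ℤ) ∣ 2 * (c * b) := by
        have := dvd_add hcase.2 g2
        ring_nf at this ⊢
        exact this
      have hc := hndvd c d hcd
      exact hpZ.not_isUnit (hab.isUnit_of_dvd'
        ((hpZ.dvd_or_dvd ((hpZ.dvd_or_dvd ha).resolve_left h2)).resolve_left hc)
        ((hpZ.dvd_or_dvd ((hpZ.dvd_or_dvd hb).resolve_left h2)).resolve_left hc))
    · exact ⟨_, _, coprime_of _ _ ⟨c, d, hcdZ, rfl, rfl⟩ hcase, hval _ _ hcdZ⟩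

theorem exists_sign_mul_eq_abs (x : ℤ) : ∃ s : ℤ, (s = 1 ∨ s = -1) ∧ s * x = |x| := by
  rcases abs_choice x with h | h
  · exact ⟨1, by simp, by rw [h, one_mul]⟩
  · exact ⟨-1, by simp, by rw [h]; ring⟩

theorem false_of_dvd_signed_sum {M p q r s σ τ : ℤ} (hM : M % 2 = 1) (h : |p| + |q| = M)
    (h1 : |p| + |r| ≤ M) (h2 : |q| + |r| ≤ M) (h3 : |p| + |s| ≤ M) (h4 : |q| + |s| ≤ M)
    (he : (p + q + r + s) % 2 = 0) (hσ : σ = 1 ∨ σ = -1) (hτ : τ = 1 ∨ τ = -1)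
    (hd : M ∣ σ * r + τ * s) : False := by
  have hz : σ * r + τ * s = 0 := by
    apply Int.eq_zero_of_abs_lt_dvd hd
    have hr := abs_le.mp (le_refl |r|)
    have hs := abs_le.mp (le_refl |s|)
    rw [abs_lt]
    rcases hσ with rfl | rfl <;> rcases hτ with rfl | rfl <;> constructor <;> omega
  have hp := abs_choice p
  have hq := abs_choice q
  rcases hσ with rfl | rfl <;> rcases hτ with rfl | rfl <;> omega

theorem false_of_dvd_left {M p q r s : ℤ} (hM : M % 2 = 1) (h : |p| + |q| = M)
    (h1 : |p| + |r| ≤ M) (h2 : |q| + |r| ≤ M) (h3 : |p| + |s| ≤ M) (h4 : |q| + |s| ≤ M)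
    (he : (p + q + r + s) % 2 = 0) (hd : M ∣ p) : False := by
  obtain ⟨k, rfl⟩ := hd
  have hM0 : 0 ≤ M := by have := abs_nonneg (M * k); have := abs_nonneg q; omega
  have hk : |k| ≤ 1 := by
    by_contra hk
    have : |M * k| = M * |k| := by rw [abs_mul, abs_of_nonneg hM0]
    have := abs_nonneg q
    nlinarith [(by omega : 0 < M)]
  have hpk : |M * k| = 0 ∨ |M * k| = M := by
    rw [abs_mul, abs_of_nonneg hM0]
    rcases (by have := abs_nonneg k; omega : |k| = 0 ∨ |k| = 1) with h0 | h0 <;> simp [h0]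
  have := abs_choice (M * k)
  have := abs_choice q
  have hr := abs_nonneg r
  have hs := abs_nonneg s
  have hr0 : r = 0 := abs_eq_zero.mp (by omega)
  have hs0 : s = 0 := abs_eq_zero.mp (by omega)
  omega

theorem gauss_not_on_boundary {M : ℕ} (hodd : M % 2 = 1) {a b : ℤ} (hab : IsCoprime a b)
    (hN : a ^ 2 + b ^ 2 = M) (v : Fin 4 → ℤ) (hv : v ∈ evenVectors) (u : Fin 4 → ℤ)
    (hu : u = (quatMatrix a b 0 0).transpose.mulVec v)
    (hle : ∀ i j, i ≠ j → |u i| + |u j| ≤ M) (i j : Fin 4) (hij : i ≠ j) :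
    |u i| + |u j| ≠ M := by
  have hev : Even (u 0 + u 1 + u 2 + u 3) := by
    rw [hu]; exact quatMatrix_transpose_mulVec_mem a b 0 0 hv
  rw [Int.even_iff] at hev
  have hMo : (M : ℤ) % 2 = 1 := by omega
  have hu0 : u 0 = a * v 0 + b * v 1 := by
    simp [hu, quatMatrix, Matrix.mulVec, dotProduct, Fin.sum_univ_four]
  have hu1 : u 1 = -b * v 0 + a * v 1 := by
    simp [hu, quatMatrix, Matrix.mulVec, dotProduct, Fin.sum_univ_four]
  have hu2 : u 2 = a * v 2 + b * v 3 := by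
    simp [hu, quatMatrix, Matrix.mulVec, dotProduct, Fin.sum_univ_four]
  have hu3 : u 3 = -b * v 2 + a * v 3 := by
    simp [hu, quatMatrix, Matrix.mulVec, dotProduct, Fin.sum_univ_four]
  have c0 : a * u 0 - b * u 1 = M * v 0 := by rw [hu0, hu1, ← hN]; ring
  have c1 : a * u 1 + b * u 0 = M * v 1 := by rw [hu0, hu1, ← hN]; ring
  have c2 : a * u 2 - b * u 3 = M * v 2 := by rw [hu2, hu3, ← hN]; ring
  have c3 : a * u 3 + b * u 2 = M * v 3 := by rw [hu2, hu3, ← hN]; ring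
  have hMa : IsCoprime (M : ℤ) a := by
    have h1 : IsCoprime (b ^ 2) a := hab.symm.pow_left
    have := (IsCoprime.add_mul_left_left h1 a)
    rwa [show b ^ 2 + a * a = M by rw [← hN]; ring] at this
  have hMab : ∀ s : ℤ, s = 1 ∨ s = -1 → IsCoprime (M : ℤ) (a + s * b) := by
    intro s hs
    have hs2 : s ^ 2 = 1 := by rcases hs with rfl | rfl <;> norm_num
    have h2 : IsCoprime (M : ℤ) 2 := by
      refine ⟨1, -(M / 2 : ℤ), ?_⟩
      omega
    have h3 : IsCoprime (M : ℤ) (2 * a ^ 2) := h2.mul_right hMa.pow_right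
    have h4 : IsCoprime (M : ℤ) (2 * a ^ 2 + M * (-1)) := h3.add_mul_left_right (-1)
    rw [show 2 * a ^ 2 + (M : ℤ) * (-1) = (a + s * b) * (a - s * b) by
      rw [← hN]; linear_combination (b ^ 2) * hs2] at h4
    exact h4.of_mul_right_left
  have e01 := hle 0 1 (by decide)
  have e02 := hle 0 2 (by decide)
  have e03 := hle 0 3 (by decide)
  have e12 := hle 1 2 (by decide)
  have e13 := hle 1 3 (by decide)
  have e23 := hle 2 3 (by decide)
  have signs := fun i => exists_sign_mul_eq_abs (u i)
  have pair01 : |u 0| + |u 1| ≠ M := by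
    intro h
    obtain ⟨s, hs, hs'⟩ := signs 0
    obtain ⟨t, ht, ht'⟩ := signs 1
    have hst : s * t = 1 ∨ s * t = -1 := by
      rcases hs with rfl | rfl <;> rcases ht with rfl | rfl <;> simp
    have ht2 : t ^ 2 = 1 := by rcases ht with rfl | rfl <;> norm_num
    have hd : (M : ℤ) ∣ (a + s * t * b) * u 0 := by
      refine ⟨v 0 + b * t, ?_⟩
      linear_combination c0 + b * t * h + b * t * hs' + b * t * ht' - b * u 1 * ht2
    exact false_of_dvd_left hMo h e02 e12 e03 e13 hev ((hMab _ hst).dvd_of_dvd_mul_left hd)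
  have pair23 : |u 2| + |u 3| ≠ M := by
    intro h
    obtain ⟨s, hs, hs'⟩ := signs 2
    obtain ⟨t, ht, ht'⟩ := signs 3
    have hst : s * t = 1 ∨ s * t = -1 := by
      rcases hs with rfl | rfl <;> rcases ht with rfl | rfl <;> simp
    have ht2 : t ^ 2 = 1 := by rcases ht with rfl | rfl <;> norm_num
    have hd : (M : ℤ) ∣ (a + s * t * b) * u 2 := by
      refine ⟨v 2 + b * t, ?_⟩
      linear_combination c2 + b * t * h + b * t * hs' + b * t * ht' - b * u 3 * ht2
    exact false_of_dvd_left hMo h (by omega) (by omega) (by omega) (by omega)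
      (r := u 0) (s := u 1) (by omega) ((hMab _ hst).dvd_of_dvd_mul_left hd)
  have pair02 : |u 0| + |u 2| ≠ M := by
    intro h
    obtain ⟨s, hs, hs'⟩ := signs 0
    obtain ⟨t, ht, ht'⟩ := signs 2
    have hd : (M : ℤ) ∣ a * (s * u 1 + t * u 3) :=
      ⟨s * v 1 + t * v 3 - b,
        by linear_combination s * c1 + t * c3 - b * h - b * hs' - b * ht'⟩
    exact false_of_dvd_signed_sum hMo h (by omega) (by omega) (by omega) (by omega)
      (by omega) hs ht (hMa.dvd_of_dvd_mul_left hd)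
  have pair03 : |u 0| + |u 3| ≠ M := by
    intro h
    obtain ⟨s, hs, hs'⟩ := signs 0
    obtain ⟨t, ht, ht'⟩ := signs 3
    have hd : (M : ℤ) ∣ a * (s * u 1 + -t * u 2) :=
      ⟨s * v 1 - t * v 2 - b,
        by linear_combination s * c1 - t * c2 - b * h - b * hs' - b * ht'⟩
    exact false_of_dvd_signed_sum hMo h (by omega) (by omega) (by omega) (by omega)
      (by omega) hs (by omega) (hMa.dvd_of_dvd_mul_left hd)
  have pair12 : |u 1| + |u 2| ≠ M := by
    intro h
    obtain ⟨s, hs, hs'⟩ := signs 1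
    obtain ⟨t, ht, ht'⟩ := signs 2
    have hd : (M : ℤ) ∣ a * (s * u 0 + -t * u 3) :=
      ⟨s * v 0 - t * v 3 + b,
        by linear_combination s * c0 - t * c3 + b * h + b * hs' + b * ht'⟩
    exact false_of_dvd_signed_sum hMo h (by omega) (by omega) (by omega) (by omega)
      (by omega) hs (by omega) (hMa.dvd_of_dvd_mul_left hd)
  have pair13 : |u 1| + |u 3| ≠ M := by
    intro h
    obtain ⟨s, hs, hs'⟩ := signs 1
    obtain ⟨t, ht, ht'⟩ := signs 3
    have hd : (M : ℤ) ∣ a * (s * u 0 + t * u 2) :=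
      ⟨s * v 0 + t * v 2 + b,
        by linear_combination s * c0 + t * c2 + b * h + b * hs' + b * ht'⟩
    exact false_of_dvd_signed_sum hMo h (by omega) (by omega) (by omega) (by omega)
      (by omega) hs ht (hMa.dvd_of_dvd_mul_left hd)
  fin_cases i <;> fin_cases j <;>
    first
    | exact absurd rfl hij
    | assumption
    | (rw [add_comm]; assumption)

set_option synthInstance.maxSize 2000 in
theorem seven_finite_check : ∀ x ∈ Finset.Icc (-7 : ℤ) 7, ∀ y ∈ Finset.Icc (-7 : ℤ) 7,
    |x| + |y| ≤ 7 → ∀ z ∈ Finset.Icc (-7 : ℤ) 7, |x| + |z| ≤ 7 → |y| + |z| ≤ 7 →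
    ∀ w ∈ Finset.Icc (-7 : ℤ) 7, |x| + |w| ≤ 7 → |y| + |w| ≤ 7 → |z| + |w| ≤ 7 →
    (2 * x - y - z - w) % 7 = 0 → (x + 2 * y - z + w) % 7 = 0 → (x + y + z + w) % 2 = 0 →
    |x| + |y| ≠ 7 ∧ |x| + |z| ≠ 7 ∧ |x| + |w| ≠ 7 ∧ |y| + |z| ≠ 7 ∧ |y| + |w| ≠ 7 ∧
      |z| + |w| ≠ 7 := by
  decide +kernel

theorem seven_not_on_boundary (v : Fin 4 → ℤ) (hv : v ∈ evenVectors) (u : Fin 4 → ℤ)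
    (hu : u = (quatMatrix 2 1 1 1).transpose.mulVec v)
    (hle : ∀ i j, i ≠ j → |u i| + |u j| ≤ (7 : ℕ)) (i j : Fin 4) (hij : i ≠ j) :
    |u i| + |u j| ≠ (7 : ℕ) := by
  have hev : Even (u 0 + u 1 + u 2 + u 3) := by
    rw [hu]; exact quatMatrix_transpose_mulVec_mem 2 1 1 1 hv
  rw [Int.even_iff] at hev
  have c0 : 2 * u 0 - u 1 - u 2 - u 3 = 7 * v 0 := by
    simp [hu, quatMatrix, Matrix.mulVec, dotProduct, Fin.sum_univ_four]
    ring
  have c1 : u 0 + 2 * u 1 - u 2 + u 3 = 7 * v 1 := by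
    simp [hu, quatMatrix, Matrix.mulVec, dotProduct, Fin.sum_univ_four]
    ring
  have mem : ∀ k l, k ≠ l → u k ∈ Finset.Icc (-7 : ℤ) 7 := by
    intro k l hkl
    have h1 := hle k l hkl
    have h2 := abs_nonneg (u l)
    rw [Finset.mem_Icc, ← abs_le]
    push_cast at h1
    omega
  push_cast at hle ⊢
  obtain ⟨p01, p02, p03, p12, p13, p23⟩ := seven_finite_check
    (u 0) (mem 0 1 (by decide)) (u 1) (mem 1 0 (by decide)) (hle 0 1 (by decide))
    (u 2) (mem 2 0 (by decide)) (hle 0 2 (by decide)) (hle 1 2 (by decide))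
    (u 3) (mem 3 0 (by decide)) (hle 0 3 (by decide)) (hle 1 3 (by decide)) (hle 2 3 (by decide))
    (by omega) (by omega) hev
  fin_cases i <;> fin_cases j <;>
    first
    | exact absurd rfl hij
    | assumption
    | (rw [add_comm]; assumption)

theorem stmt14 (M : ℕ) (hM : 0 < M)
    (h : M = 7 ∨ ∀ p : ℕ, p.Prime → p ∣ M → p % 4 = 1) :
    ∃ Λ' : AddSubgroup (EuclideanSpace ℝ (Fin 4)),
      IsStrictlySimilarSublattice D4 Λ' (M ^ 2) ∧ IsClean D4 Λ' := by
  rcases h with rfl | h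
  · exact exists_clean_of_quatMatrix (a := 2) (b := 1) (c := 1) (d := 1) hM (by norm_num)
      seven_not_on_boundary
  · obtain ⟨a, b, hab, hN⟩ := exists_isCoprime_sq_add_sq hM h
    have hodd : M % 2 = 1 := by
      by_contra hodd
      have := h 2 Nat.prime_two (by omega)
      omega
    exact exists_clean_of_quatMatrix hM (a := a) (b := b) (c := 0) (d := 0)
      (by rw [← hN]; ring) (gauss_not_on_boundary hodd hab hN)
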